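/- arXiv:1402.0462 — 4 statements merged into one kernel-verified Lean document; each statement's English description precedes it below -/
import Mathlib

section
/- Let f = b_0 + Σ_{j=1}^{n} b_j·X^{α(j)} − Σ_{i=1}^{k} a_i·X^{y(i)} be as in the context. If f is nonnegative on ℝⁿ, then f attains a global minimum at a point with all coordinates strictly positive: there exists v ∈ ℝ_{>0}ⁿ such that f(v) ≤ f(x) for all x ∈ ℝⁿ. -/
open MvPolynomial

section SignomialMinimum

variable {ι κ : Type*} [Fintype ι] [Fintype κ]

/-- Sublinear powers are eventually dominated by a linear function. -/
lemma eventually_sum_mul_rpow_le (a s : κ → ℝ) (hs : ∀ i, s i < 1) {c : ℝ} (hc : 0 < c) :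
    ∀ᶠ M : ℝ in Filter.atTop, ∑ i, a i * M ^ s i ≤ c * M := by
  have h : Filter.Tendsto (fun M : ℝ => ∑ i, a i * M ^ (-(1 - s i))) Filter.atTop (nhds 0) := by
    simpa using tendsto_finsetSum Finset.univ fun i _ =>
      (tendsto_rpow_neg_atTop (sub_pos.2 (hs i))).const_mul (a i)
  filter_upwards [h.eventually_le_const hc, Filter.eventually_gt_atTop 0] with M hM hpos
  calc ∑ i, a i * M ^ s i = (∑ i, a i * M ^ (-(1 - s i))) * M := by
        rw [Finset.sum_mul]
        refine Finset.sum_congr rfl fun i _ => ?_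
        rw [mul_assoc, ← Real.rpow_add_one hpos.ne']
        congr 2
        ring
    _ ≤ c * M := by gcongr

/-- A positive linear form minus sublinear monomials takes a negative value at a positive
multiple of the all-ones vector. -/
lemma exists_pos_signomial_neg [Nonempty κ] (b : ι → ℝ) (a : κ → ℝ) (ha : ∀ i, 0 < a i)
    (lam : κ → ι → ℝ) (hsum : ∀ i, ∑ j, lam i j < 1) :
    ∃ t : ℝ, 0 < t ∧ ∑ j, b j * t - ∑ i, a i * ∏ j, t ^ lam i j < 0 := by
  obtain ⟨i₀⟩ := ‹Nonempty κ›
  have hpos : 0 < 1 - ∑ j, lam i₀ j := sub_pos.2 (hsum i₀)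
  have hlim : Filter.Tendsto (fun t : ℝ => (∑ j, b j) * t ^ (1 - ∑ j, lam i₀ j))
      (nhdsWithin 0 (Set.Ioi 0)) (nhds 0) := by
    have h := ((Real.continuous_rpow_const hpos.le).tendsto 0).const_mul (∑ j, b j)
    rw [Real.zero_rpow hpos.ne', mul_zero] at h
    exact h.mono_left nhdsWithin_le_nhds
  obtain ⟨t, hlt, ht⟩ :=
    ((hlim.eventually_lt_const (ha i₀)).and self_mem_nhdsWithin).exists
  have ht : 0 < t := ht
  refine ⟨t, ht, sub_neg.2 ?_⟩
  calc ∑ j, b j * t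
      = (∑ j, b j) * t ^ (1 - ∑ j, lam i₀ j) * t ^ ∑ j, lam i₀ j := by
        rw [mul_assoc, ← Real.rpow_add ht, sub_add_cancel, Real.rpow_one, Finset.sum_mul]
    _ < a i₀ * t ^ ∑ j, lam i₀ j := by gcongr
    _ = a i₀ * ∏ j, t ^ lam i₀ j := by rw [Real.rpow_sum_of_pos ht]
    _ ≤ ∑ i, a i * ∏ j, t ^ lam i j :=
        Finset.single_le_sum (f := fun i => a i * ∏ j, t ^ lam i j)
          (fun i _ => mul_nonneg (ha i).le (Finset.prod_nonneg fun j _ => by positivity))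
          (Finset.mem_univ i₀)

/-- A positive linear form minus sublinear monomials attains its minimum over the closed
orthant at an interior point. -/
lemma exists_pos_signomial_min [Nonempty ι] [Nonempty κ]
    (b : ι → ℝ) (hb : ∀ j, 0 < b j) (a : κ → ℝ) (ha : ∀ i, 0 < a i)
    (lam : κ → ι → ℝ) (hlam : ∀ i j, 0 < lam i j) (hsum : ∀ i, ∑ j, lam i j < 1) :
    ∃ u : ι → ℝ, (∀ j, 0 < u j) ∧ ∀ w : ι → ℝ, (∀ j, 0 ≤ w j) →
      ∑ j, b j * u j - ∑ i, a i * ∏ j, u j ^ lam i j ≤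
        ∑ j, b j * w j - ∑ i, a i * ∏ j, w j ^ lam i j := by
  set g : (ι → ℝ) → ℝ := fun u => ∑ j, b j * u j - ∑ i, a i * ∏ j, u j ^ lam i j with hg
  have hcont : Continuous g := by
    refine (by fun_prop : Continuous fun u : ι → ℝ => ∑ j, b j * u j).sub
      (continuous_finsetSum _ fun i _ => continuous_const.mul
        (continuous_finsetProd _ fun j _ =>
          (Real.continuous_rpow_const (hlam i j).le).comp (continuous_apply j)))
  have hclosed : IsClosed {u : ι → ℝ | ∀ j, 0 ≤ u j} := by
    simp only [Set.ofPred_forall]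
    exact isClosed_iInter fun j => isClosed_le continuous_const (continuous_apply j)
  obtain ⟨t, ht, hneg⟩ := exists_pos_signomial_neg b a ha lam hsum
  obtain ⟨j₀, hj₀⟩ := Finite.exists_min b
  have hcoer : ∀ᶠ u in Filter.cocompact (ι → ℝ) ⊓ Filter.principal {u | ∀ j, 0 ≤ u j},
      g (fun _ => t) ≤ g u := by
    rw [Filter.eventually_inf_principal]
    filter_upwards [(tendsto_norm_cocompact_atTop (E := ι → ℝ)).eventually
      (eventually_sum_mul_rpow_le a _ hsum (hb j₀))] with u hu hu0
    have hu0 : ∀ j, 0 ≤ u j := hu0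
    refine hneg.le.trans (sub_nonneg.2 ?_)
    calc ∑ i, a i * ∏ j, u j ^ lam i j ≤ ∑ i, a i * ‖u‖ ^ ∑ j, lam i j := by
          refine Finset.sum_le_sum fun i _ => mul_le_mul_of_nonneg_left ?_ (ha i).le
          rw [Real.rpow_sum_of_nonneg (norm_nonneg u) fun j _ => (hlam i j).le]
          refine Finset.prod_le_prod (fun j _ => Real.rpow_nonneg (hu0 j) _) fun j _ =>
            Real.rpow_le_rpow (hu0 j) ?_ (hlam i j).le
          exact (Real.le_norm_self _).trans (norm_le_pi_norm u j)
      _ ≤ b j₀ * ‖u‖ := hu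
      _ ≤ ∑ j, b j * u j := by
          have hterm : ∀ j, 0 ≤ b j * u j := fun j => mul_nonneg (hb j).le (hu0 j)
          rw [mul_comm, ← le_div_iff₀ (hb j₀), pi_norm_le_iff_of_nonneg
            (div_nonneg (Finset.sum_nonneg fun j _ => hterm j) (hb j₀).le)]
          intro j
          rw [Real.norm_of_nonneg (hu0 j), le_div_iff₀ (hb j₀), mul_comm]
          exact (mul_le_mul_of_nonneg_right (hj₀ j) (hu0 j)).trans
            (Finset.single_le_sum (f := fun j => b j * u j) (fun j _ => hterm j)
              (Finset.mem_univ j))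
  obtain ⟨u, hu0, hmin⟩ := hcont.continuousOn.exists_isMinOn' hclosed
    (x₀ := fun _ => t) (fun _ => ht.le) hcoer
  have hu0 : ∀ j, 0 ≤ u j := hu0
  refine ⟨u, fun j => (hu0 j).lt_of_ne' fun hj => ?_, fun w hw => hmin hw⟩
  have hzero : ∀ i, ∏ j, u j ^ lam i j = 0 := fun i =>
    Finset.prod_eq_zero (Finset.mem_univ j) (by rw [hj, Real.zero_rpow (hlam i j).ne'])
  have hgu : 0 ≤ g u := by
    simp only [hg, hzero, mul_zero, Finset.sum_const_zero, sub_zero]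
    exact Finset.sum_nonneg fun j _ => mul_nonneg (hb j).le (hu0 j)
  have hle : g u ≤ g fun _ => t := hmin (fun _ => ht.le : (fun _ => t) ∈ {u : ι → ℝ | ∀ j, 0 ≤ u j})
  exact absurd (hgu.trans hle) (not_le.2 hneg)

/-- A monomial whose exponent is a nonnegative combination of other exponents is the
corresponding product of powers of the other monomials. -/
lemma prod_pow_eq_prod_rpow {σ : Type*} [Fintype σ] (α : ι → σ → ℕ) (y : σ → ℕ) (lam : ι → ℝ)
    (hlam : ∀ j, 0 ≤ lam j) (hy : ∀ l, (y l : ℝ) = ∑ j, lam j * (α j l : ℝ))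
    (x : σ → ℝ) (hx : ∀ l, 0 ≤ x l) :
    ∏ l, x l ^ y l = ∏ j, (∏ l, x l ^ α j l) ^ lam j := by
  calc ∏ l, x l ^ y l = ∏ l, ∏ j, (x l ^ α j l) ^ lam j := by
        refine Finset.prod_congr rfl fun l _ => ?_
        rw [← Real.rpow_natCast, hy, Real.rpow_sum_of_nonneg (hx l)
          fun j _ => mul_nonneg (hlam j) (Nat.cast_nonneg _)]
        refine Finset.prod_congr rfl fun j _ => ?_
        rw [mul_comm, Real.rpow_mul (hx l), Real.rpow_natCast]
    _ = ∏ j, ∏ l, (x l ^ α j l) ^ lam j := Finset.prod_comm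
    _ = ∏ j, (∏ l, x l ^ α j l) ^ lam j := Finset.prod_congr rfl fun j _ =>
        Real.finsetProd_rpow _ _ (fun l _ => pow_nonneg (hx l) _) _

/-- Monomials with linearly independent exponents take any prescribed positive values at some
positive point. -/
lemma exists_pos_prod_pow_eq [DecidableEq ι] (α : ι → ι → ℕ)
    (hlin : LinearIndependent ℝ (fun j : ι => (fun i : ι => (α j i : ℝ))))
    (u : ι → ℝ) (hu : ∀ j, 0 < u j) :
    ∃ v : ι → ℝ, (∀ l, 0 < v l) ∧ ∀ j, ∏ l, v l ^ α j l = u j := by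
  have hunit : IsUnit (Matrix.of fun j i => (α j i : ℝ)) :=
    Matrix.linearIndependent_rows_iff_isUnit.1 hlin
  obtain ⟨w, hw⟩ := Matrix.mulVec_surjective_iff_isUnit.2 hunit fun j => Real.log (u j)
  refine ⟨fun l => Real.exp (w l), fun l => Real.exp_pos _, fun j => ?_⟩
  have hj : ∑ l, (α j l : ℝ) * w l = Real.log (u j) := congrFun hw j
  simp only [← Real.exp_nat_mul]
  rw [← Real.exp_sum, hj, Real.exp_log (hu j)]

end SignomialMinimum

/-- If `f = b₀ + Σ_j b_j X^{α(j)} − Σ_i a_i X^{y(i)}` (simplex Newton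
polytope with even vertices, interior lattice exponents `y(i)`) is nonnegative on ℝⁿ, then
`f` attains a global minimum at a point with all coordinates strictly positive. -/
theorem simplex_poly_positive_minimizer
    (n k : ℕ) (hn : 1 ≤ n) (hk : 1 ≤ k)
    (α : Fin n → Fin n → ℕ)
    (hαeven : ∀ j i, Even (α j i))
    (hlin : LinearIndependent ℝ (fun j : Fin n => (fun i : Fin n => (α j i : ℝ))))
    (b₀ : ℝ) (hb₀ : 0 < b₀)
    (b : Fin n → ℝ) (hb : ∀ j, 0 < b j)
    (a : Fin k → ℝ) (ha : ∀ i, 0 < a i)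
    (y : Fin k → Fin n → ℕ) (hydist : Function.Injective y)
    (lam₀ : Fin k → ℝ) (lam : Fin k → Fin n → ℝ)
    (hlam₀ : ∀ i, 0 < lam₀ i) (hlam : ∀ i j, 0 < lam i j)
    (hlamsum : ∀ i, lam₀ i + ∑ j, lam i j = 1)
    (hy : ∀ i l, (y i l : ℝ) = ∑ j, lam i j * (α j l : ℝ))
    (f : MvPolynomial (Fin n) ℝ)
    (hf : f = C b₀ + ∑ j, C (b j) * ∏ l, X l ^ α j l
        - ∑ i, C (a i) * ∏ l, X l ^ y i l)
    (hnonneg : ∀ x : Fin n → ℝ, 0 ≤ eval x f) :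
    ∃ v : Fin n → ℝ, (∀ l, 0 < v l) ∧ ∀ x : Fin n → ℝ, eval v f ≤ eval x f := by
  have : Nonempty (Fin n) := ⟨⟨0, hn⟩⟩
  have : Nonempty (Fin k) := ⟨⟨0, hk⟩⟩
  have heval : ∀ x, eval x f =
      b₀ + ∑ j, b j * ∏ l, x l ^ α j l - ∑ i, a i * ∏ l, x l ^ y i l := fun x => by
    simp [hf]
  obtain ⟨u, hu, hmin⟩ := exists_pos_signomial_min b hb a ha lam hlam fun i => by
    linarith [hlam₀ i, hlamsum i]
  obtain ⟨v, hv, hvu⟩ := exists_pos_prod_pow_eq α hlin u hu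
  refine ⟨v, hv, fun x => ?_⟩
  have hmono : ∀ (z : Fin n → ℝ), (∀ l, 0 ≤ z l) → ∀ i,
      ∏ l, z l ^ y i l = ∏ j, (∏ l, z l ^ α j l) ^ lam i j := fun z hz i =>
    prod_pow_eq_prod_rpow α (y i) (lam i) (fun j => (hlam i j).le) (hy i) z hz
  have habs := hmin (fun j => ∏ l, |x l| ^ α j l)
    fun j => Finset.prod_nonneg fun l _ => by positivity
  have hα : ∀ j, ∏ l, |x l| ^ α j l = ∏ l, x l ^ α j l := fun j =>
    Finset.prod_congr rfl fun l _ => (hαeven j l).pow_abs _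
  have hyabs : ∑ i, a i * ∏ l, x l ^ y i l ≤ ∑ i, a i * ∏ l, |x l| ^ y i l := by
    refine Finset.sum_le_sum fun i _ => mul_le_mul_of_nonneg_left ?_ (ha i).le
    refine (le_abs_self _).trans_eq ?_
    simp only [Finset.abs_prod, abs_pow]
  simp only [hmono (fun l => |x l|) fun l => abs_nonneg _, hα] at hyabs
  simp only [hα] at habs
  simp only [heval, hmono v fun l => (hv l).le, hvu]
  linarith
end

section
/- Let v_0, v_1, v_2 ∈ (2ℕ)² be affinely independent, let Δ = conv{v_0, v_1, v_2} ⊂ ℝ², and suppose the boundary of the triangle ½Δ contains at least four points of ℤ². Then Δ is an H-simplex: every lattice point β ∈ (Δ ∩ ℤ²) \ {v_0, v_1, v_2} can be written as β = (s + t)/2 for two distinct points s, t ∈ Δ ∩ (2ℤ)². -/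
/-- The planar cross product. -/
def latticeCross (u v : Fin 2 → ℤ) : ℤ := u 0 * v 1 - u 1 * v 0

/-- A set of planar lattice points containing each lattice point that is a rational convex
combination of three of its points. -/
def LatticeConvex (K : Set (Fin 2 → ℤ)) : Prop :=
  ∀ a ∈ K, ∀ b ∈ K, ∀ c ∈ K, ∀ x y z : ℤ, 0 ≤ x → 0 ≤ y → 0 ≤ z → 0 < x + y + z →
    ∀ v : Fin 2 → ℤ, (x + y + z) • v = x • a + y • b + z • c → v ∈ K

/-- A lattice point of `2 • T`, for a lattice triangle `T`, is a sum of two lattice points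
of `T`. -/
theorem LatticeConvex.exists_add_eq {K : Set (Fin 2 → ℤ)} (hK : LatticeConvex K)
    (β : Fin 2 → ℤ) (n : ℕ) :
    ∀ a ∈ K, ∀ b ∈ K, ∀ c ∈ K, ∀ x y z : ℤ, 0 ≤ x → 0 ≤ y → 0 ≤ z → 0 < x + y + z →
      x + y + z ≤ n → (x + y + z) • β = (2 : ℤ) • (x • a + y • b + z • c) →
      ∃ s ∈ K, ∃ t ∈ K, s + t = β := by
  induction n with
  | zero => intro a _ b _ c _ x y z _ _ _ h h'; simp at h'; omega
  | succ n ih =>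
    intro a ha b hb c hc x y z hx hy hz hpos hn h
    by_cases hxl : y + z ≤ x
    · refine ⟨a, ha, β - a, hK a ha b hb c hc (x - y - z) (2 * y) (2 * z) (by omega) (by omega)
        (by omega) (by omega) _ ?_, by abel⟩
      linear_combination (exp := 1) h
    by_cases hyl : x + z ≤ y
    · refine ⟨b, hb, β - b, hK a ha b hb c hc (2 * x) (y - x - z) (2 * z) (by omega) (by omega)
        (by omega) (by omega) _ ?_, by abel⟩
      linear_combination (exp := 1) h
    by_cases hzl : x + y ≤ z
    · refine ⟨c, hc, β - c, hK a ha b hb c hc (2 * x) (2 * y) (z - x - y) (by omega) (by omega)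
        (by omega) (by omega) _ ?_, by abel⟩
      linear_combination (exp := 1) h
    have hq : a + b + c - β ∈ K := by
      refine hK a ha b hb c hc (y + z - x) (x + z - y) (x + y - z) (by omega) (by omega)
        (by omega) (by omega) _ ?_
      linear_combination (exp := 1) -h
    push_cast at hn
    rcases le_total x y with hxy | hxy <;> rcases le_total x z with hxz | hxz <;>
      rcases le_total y z with hyz | hyz
    all_goals first
      | exact ih _ hq b hb c hc x (y - x) (z - x) (by omega) (by omega) (by omega) (by omega)
          (by omega) (by linear_combination (exp := 1) h)
      | exact ih a ha _ hq c hc (x - y) y (z - y) (by omega) (by omega) (by omega) (by omega)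
          (by omega) (by linear_combination (exp := 1) h)
      | exact ih a ha b hb _ hq (x - z) (y - z) z (by omega) (by omega) (by omega) (by omega)
          (by omega) (by linear_combination (exp := 1) h)

theorem LatticeConvex.mem_of_smul_mem {K : Set (Fin 2 → ℤ)} (hK : LatticeConvex K)
    (h0 : (0 : Fin 2 → ℤ) ∈ K) {k : ℤ} (hk : 0 < k) {v : Fin 2 → ℤ} (hv : k • v ∈ K) :
    v ∈ K :=
  hK _ hv 0 h0 0 h0 1 (k - 1) 0 (by omega) (by omega) le_rfl (by omega) v (by module)

/-- If the origin is interior to a triangle spanned by a lattice-convex set without opposite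
points, then the set contains a unimodular triangle centred at the origin. -/
theorem LatticeConvex.exists_unimodular {K : Set (Fin 2 → ℤ)} (hK : LatticeConvex K)
    (h0 : (0 : Fin 2 → ℤ) ∈ K) (hsymm : ∀ v ∈ K, -v ∈ K → v = 0) (n : ℕ) :
    ∀ a ∈ K, ∀ b ∈ K, ∀ c ∈ K, 0 < latticeCross a b → 0 < latticeCross b c →
      0 < latticeCross c a → latticeCross a b + latticeCross b c + latticeCross c a ≤ n →
      ∃ u ∈ K, ∃ v ∈ K, ∃ w ∈ K, latticeCross u v = 1 ∧ u + v + w = 0 := by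
  induction n with
  | zero => intro a _ b _ c _ h1 h2 h3 h4; simp at h4; omega
  | succ n ih =>
    have key : ∀ a ∈ K, ∀ b ∈ K, ∀ c ∈ K, 1 < latticeCross a b → 0 < latticeCross b c →
      0 < latticeCross c a → latticeCross a b + latticeCross b c + latticeCross c a ≤ n + 1 →
      ∃ u ∈ K, ∃ v ∈ K, ∃ w ∈ K, latticeCross u v = 1 ∧ u + v + w = 0 := by
      intro a ha b hb c hc hab hbc hca hn
      obtain ⟨a', hg⟩ : ∃ a' : Fin 2 → ℤ, a = (Int.gcd (a 0) (a 1) : ℤ) • a' := by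
        refine ⟨fun i => a i / (Int.gcd (a 0) (a 1) : ℤ), ?_⟩
        ext i
        fin_cases i
        · exact (Int.mul_ediv_cancel' (Int.gcd_dvd_left ..)).symm
        · exact (Int.mul_ediv_cancel' (Int.gcd_dvd_right ..)).symm
      have hgcd := Int.gcd_eq_gcd_ab (a 0) (a 1)
      have hgpos : (0 : ℤ) < Int.gcd (a 0) (a 1) := by
        rcases Nat.eq_zero_or_pos (Int.gcd (a 0) (a 1)) with h | h
        · rw [h] at hg
          simp [hg, latticeCross] at hab
        · exact_mod_cast h
      generalize (Int.gcd (a 0) (a 1) : ℤ) = g at hg hgcd hgpos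
      have ha' : a' ∈ K := hK.mem_of_smul_mem h0 hgpos (hg ▸ ha)
      rcases (show 1 ≤ g from hgpos).eq_or_lt with rfl | hg1
      · set e : Fin 2 → ℤ := ![-Int.gcdB (a 0) (a 1), Int.gcdA (a 0) (a 1)] with he
        have hae : latticeCross a e = 1 := by simp [latticeCross, he]; linarith
        obtain ⟨v, f, hf0, hfd, hav, hdv⟩ : ∃ v : Fin 2 → ℤ, ∃ f : ℤ, 0 ≤ f ∧
            f < latticeCross a b ∧ latticeCross a v = 1 ∧
            latticeCross a b • v = b + f • a := by
          have hdm := Int.emod_add_mul_ediv (-latticeCross b e) (latticeCross a b)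
          refine ⟨e - ((-latticeCross b e) / latticeCross a b) • a,
            (-latticeCross b e) % latticeCross a b, Int.emod_nonneg _ (by omega),
            Int.emod_lt_of_pos _ (by omega), ?_, ?_⟩
          · simp only [latticeCross, Pi.sub_apply, Pi.smul_apply, smul_eq_mul] at hae ⊢
            linear_combination hae
          · have hbe : b = latticeCross b e • a + latticeCross a b • e := by
              ext i
              fin_cases i <;> simp [latticeCross] at hae ⊢
              · linear_combination -b 0 * hae
              · linear_combination -b 1 * hae
            linear_combination (exp := 1) -hbe - hdm • a
        have hv : v ∈ K := hK b hb a ha 0 h0 1 f (latticeCross a b - 1 - f) (by omega) hf0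
          (by omega) (by omega) v (by linear_combination (exp := 1) hdv)
        have hvb : latticeCross v b = f := by
          have h : latticeCross a b * latticeCross v b = latticeCross a b * f := by
            have h0 := congrFun hdv 0
            have h1 := congrFun hdv 1
            simp only [latticeCross, Pi.add_apply, Pi.smul_apply, smul_eq_mul] at h0 h1 ⊢
            linear_combination b 1 * h0 - b 0 * h1
          exact mul_left_cancel₀ (by omega) h
        have hvc : latticeCross a b * latticeCross v c =
            latticeCross b c - f * latticeCross c a := by
          have h0 := congrFun hdv 0
          have h1 := congrFun hdv 1
          simp only [latticeCross, Pi.add_apply, Pi.smul_apply, smul_eq_mul] at h0 h1 ⊢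
          linear_combination c 1 * h0 - c 0 * h1
        have hcv : latticeCross c v = -latticeCross v c := by simp [latticeCross]; ring
        have hfca : 0 ≤ f * latticeCross c a := by positivity
        rcases lt_trichotomy (latticeCross v c) 0 with h | h | h
        · have hf : 0 < f := by
            rcases hf0.eq_or_lt with rfl | hf
            · nlinarith
            · exact hf
          refine ih v hv b hb c hc (by omega) hbc (by omega) ?_
          have : latticeCross c v < latticeCross c a := by nlinarith
          omega
        · have hc' : c = latticeCross c a • (-v) := by
            ext i
            fin_cases i <;> simp [latticeCross] at h hav ⊢
            · linear_combination -c 0 * hav - a 0 * h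
            · linear_combination -c 1 * hav - a 1 * h
          have := hsymm v hv (hK.mem_of_smul_mem h0 hca (hc' ▸ hc))
          simp [this, latticeCross] at hav
        · refine ih a ha v hv c hc (by omega) h hca ?_
          have : latticeCross v c ≤ latticeCross b c := by nlinarith
          omega
      · obtain h := ih a' ha' b hb c hc
        have e1 : latticeCross a b = g * latticeCross a' b := by
          rw [hg]; simp [latticeCross]; ring
        have e2 : latticeCross c a = g * latticeCross c a' := by
          rw [hg]; simp [latticeCross]; ring
        have p1 : 0 < latticeCross a' b := by
          by_contra! h; nlinarith
        have p2 : 0 < latticeCross c a' := by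
          by_contra! h; nlinarith
        exact h p1 hbc p2 (by nlinarith)
    intro a ha b hb c hc hab hbc hca hn
    push_cast at hn
    by_cases h1 : 1 < latticeCross a b
    · exact key a ha b hb c hc h1 hbc hca hn
    by_cases h2 : 1 < latticeCross b c
    · exact key b hb c hc a ha h2 hca hab (by linarith)
    by_cases h3 : 1 < latticeCross c a
    · exact key c hc a ha b hb h3 hab hbc (by linarith)
    refine ⟨a, ha, b, hb, c, hc, by omega, ?_⟩
    have h1 : latticeCross a b = 1 := by omega
    have h2 : latticeCross b c = 1 := by omega
    have h3 : latticeCross c a = 1 := by omega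
    have : latticeCross b c • a + latticeCross c a • b + latticeCross a b • c = 0 := by
      ext i
      fin_cases i <;> simp [latticeCross] <;> ring
    simpa [h1, h2, h3] using this

/-- If a lattice-convex set containing the origin contains no pair of opposite points, and the
origin is interior to a triangle spanned by it, then it lies on three rays. -/
theorem LatticeConvex.exists_three_rays {K : Set (Fin 2 → ℤ)} (hK : LatticeConvex K)
    (h0 : (0 : Fin 2 → ℤ) ∈ K) (hsymm : ∀ v ∈ K, -v ∈ K → v = 0)
    {a b c : Fin 2 → ℤ} (ha : a ∈ K) (hb : b ∈ K) (hc : c ∈ K) (hab : 0 < latticeCross a b)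
    (hbc : 0 < latticeCross b c) (hca : 0 < latticeCross c a) :
    ∃ w : Fin 3 → Fin 2 → ℤ, ∀ r ∈ K, ∃ i, ∃ n : ℤ, 0 ≤ n ∧ r = n • w i := by
  obtain ⟨u, hu, v, hv, w, hw, huv, hsum⟩ := hK.exists_unimodular h0 hsymm
    (latticeCross a b + latticeCross b c + latticeCross c a).toNat a ha b hb c hc hab hbc hca
    (by omega)
  have hu0 : u ≠ 0 := by rintro rfl; simp [latticeCross] at huv
  have hv0 : v ≠ 0 := by rintro rfl; simp [latticeCross] at huv
  have hw0 : w ≠ 0 := by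
    rintro rfl
    obtain rfl : u = -v := by linear_combination (exp := 1) hsum
    simp [latticeCross] at huv
    linarith
  have key : ∀ p ∈ K, ∀ q ∈ K, -(p + q) ∈ K → -(p + q) ≠ 0 → ∀ i j : ℤ, 0 < i → 0 < j →
      i • p + j • q ∉ K := by
    intro p hp q hq hpq hne i j hi hj hr
    refine hne (hsymm _ hpq ?_)
    rcases le_total i j with hij | hij
    · exact hK _ hr p hp 0 h0 1 (j - i) (i - 1) (by omega) (by omega) (by omega) (by omega) _
        (by module)
    · exact hK _ hr q hq 0 h0 1 (i - j) (j - 1) (by omega) (by omega) (by omega) (by omega) _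
        (by module)
  have ew : -(u + v) = w := by linear_combination (exp := 1) -hsum
  have eu : -(v + w) = u := by linear_combination (exp := 1) -hsum
  have ev : -(w + u) = v := by linear_combination (exp := 1) -hsum
  refine ⟨![u, v, w], fun r hr => ?_⟩
  obtain ⟨i, j, rfl⟩ : ∃ i j : ℤ, r = i • u + j • v := by
    refine ⟨latticeCross r v, latticeCross u r, ?_⟩
    ext k
    fin_cases k <;> simp [latticeCross] at huv ⊢
    · linear_combination -r 0 * huv
    · linear_combination -r 1 * huv
  have h1 := fun i j hi hj => key u hu v hv (ew ▸ hw) (ew ▸ hw0) i j hi hj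
  have h2 := fun i j hi hj => key v hv w hw (eu ▸ hu) (eu ▸ hu0) i j hi hj
  have h3 := fun i j hi hj => key w hw u hu (ev ▸ hv) (ev ▸ hv0) i j hi hj
  have e2 : i • u + j • v = (j - i) • v + (-i) • w := by
    linear_combination (exp := 1) i • hsum
  have e3 : i • u + j • v = (-j) • w + (i - j) • u := by
    linear_combination (exp := 1) j • hsum
  by_cases hi : 0 < i
  · by_cases hj : 0 < j
    · exact absurd hr (h1 i j hi hj)
    by_cases hj' : j = 0
    · exact ⟨0, i, hi.le, by simp [hj']⟩
    · exact absurd (e3 ▸ hr) (h3 _ _ (by omega) (by omega))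
  · rcases lt_trichotomy i j with hij | hij | hij
    · by_cases hi' : i = 0
      · exact ⟨1, j, by omega, by simp [hi']⟩
      · exact absurd (e2 ▸ hr) (h2 _ _ (by omega) (by omega))
    · exact ⟨2, -i, by omega, by rw [e2, hij]; simp⟩
    · exact absurd (e3 ▸ hr) (h3 _ _ (by omega) (by omega))

theorem LatticeConvex.translate {K : Set (Fin 2 → ℤ)} (hK : LatticeConvex K)
    (p : Fin 2 → ℤ) : LatticeConvex {v | v + p ∈ K} := by
  intro a ha b hb c hc x y z hx hy hz hpos v hv
  exact hK _ ha _ hb _ hc x y z hx hy hz hpos _ (by linear_combination (exp := 1) hv)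

theorem Convex.latticeConvex {C : Set (Fin 2 → ℝ)} (hC : Convex ℝ C) :
    LatticeConvex {v | (fun i => (v i : ℝ)) ∈ C} := by
  intro a ha b hb c hc x y z hx hy hz hpos v hv
  have hS : (0 : ℝ) < x + y + z := by exact_mod_cast hpos
  have hx' : (0 : ℝ) ≤ x := by exact_mod_cast hx
  have hy' : (0 : ℝ) ≤ y := by exact_mod_cast hy
  have hz' : (0 : ℝ) ≤ z := by exact_mod_cast hz
  have := hC.sum_mem (t := Finset.univ) (w := ![(x : ℝ) / (x + y + z), (y : ℝ) / (x + y + z),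
    (z : ℝ) / (x + y + z)]) (z := ![fun i => (a i : ℝ), fun i => (b i : ℝ), fun i => (c i : ℝ)])
    (by intro i _; fin_cases i <;> simp <;> positivity)
    (by simp [Fin.sum_univ_three]; field_simp)
    (by intro i _; fin_cases i; exacts [ha, hb, hc])
  change (fun i => (v i : ℝ)) ∈ C
  convert this using 1
  ext i
  have h : ((x + y + z : ℤ) : ℝ) * v i = x * a i + y * b i + z * c i := by
    exact_mod_cast congrFun hv i
  push_cast at h
  simp only [Fin.sum_univ_three, Pi.add_apply, Pi.smul_apply, smul_eq_mul, Matrix.cons_val]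
  field_simp
  linarith

theorem mem_convexHull_three {a b c p : Fin 2 → ℝ} :
    p ∈ convexHull ℝ {a, b, c} ↔ ∃ x y z : ℝ, 0 ≤ x ∧ 0 ≤ y ∧ 0 ≤ z ∧ x + y + z = 1 ∧
      x • a + y • b + z • c = p := by
  constructor
  · intro h
    rw [convexHull_insert (by simp), mem_convexJoin] at h
    obtain ⟨a', rfl, q, hq, hp⟩ := h
    rw [convexHull_pair] at hq
    obtain ⟨s, t, hs, ht, hst, rfl⟩ := hq
    obtain ⟨x, y, hx, hy, hxy, rfl⟩ := hp
    refine ⟨x, y * s, y * t, hx, by positivity, by positivity, ?_, by module⟩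
    linear_combination hxy + y * hst
  · rintro ⟨x, y, z, hx, hy, hz, h, rfl⟩
    have := (convex_convexHull ℝ {a, b, c}).sum_mem (t := Finset.univ) (w := ![x, y, z])
      (z := ![a, b, c]) (by intro i _; fin_cases i <;> simpa)
      (by simpa [Fin.sum_univ_three] using h)
      (by intro i _; fin_cases i <;> exact subset_convexHull ℝ _ (by simp))
    simpa [Fin.sum_univ_three] using this

theorem latticeCross_nonneg_of_mem_convexHull {a b c p : Fin 2 → ℤ}
    (hD : 0 < latticeCross (b - a) (c - a))
    (hp : (fun i => (p i : ℝ)) ∈ convexHull ℝ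
      ({fun i => (a i : ℝ), fun i => (b i : ℝ), fun i => (c i : ℝ)} : Set (Fin 2 → ℝ))) :
    0 ≤ latticeCross (a - p) (b - p) ∧ 0 ≤ latticeCross (b - p) (c - p) ∧
      0 ≤ latticeCross (c - p) (a - p) := by
  obtain ⟨x, y, z, hx, hy, hz, hs, h⟩ := mem_convexHull_three.1 hp
  have h0 := congrFun h 0
  have h1 := congrFun h 1
  have hD' : (0 : ℝ) < (latticeCross (b - a) (c - a) : ℤ) := by exact_mod_cast hD
  simp only [Pi.add_apply, Pi.smul_apply, smul_eq_mul] at h0 h1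
  obtain rfl : x = 1 - y - z := by linarith
  refine ⟨?_, ?_, ?_⟩ <;> rify
  · have : ((latticeCross (a - p) (b - p) : ℤ) : ℝ) =
        z * (latticeCross (b - a) (c - a) : ℤ) := by
      simp only [latticeCross, Pi.sub_apply]
      push_cast
      rw [← h0, ← h1]
      ring
    rw [this]
    positivity
  · have : ((latticeCross (b - p) (c - p) : ℤ) : ℝ) =
        (1 - y - z) * (latticeCross (b - a) (c - a) : ℤ) := by
      simp only [latticeCross, Pi.sub_apply]
      push_cast
      rw [← h0, ← h1]
      ring
    rw [this]
    positivity
  · have : ((latticeCross (c - p) (a - p) : ℤ) : ℝ) =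
        y * (latticeCross (b - a) (c - a) : ℤ) := by
      simp only [latticeCross, Pi.sub_apply]
      push_cast
      rw [← h0, ← h1]
      ring
    rw [this]
    positivity

theorem mem_interior_convexHull_of_latticeCross_pos {a b c p : Fin 2 → ℤ}
    (hab : 0 < latticeCross (a - p) (b - p)) (hbc : 0 < latticeCross (b - p) (c - p))
    (hca : 0 < latticeCross (c - p) (a - p)) :
    (fun i => (p i : ℝ)) ∈ interior (convexHull ℝ
      ({fun i => (a i : ℝ), fun i => (b i : ℝ), fun i => (c i : ℝ)} : Set (Fin 2 → ℝ))) := by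
  let f : (Fin 2 → ℤ) → (Fin 2 → ℤ) → (Fin 2 → ℝ) → ℝ := fun u v r =>
    (u 0 - r 0) * (v 1 - r 1) - (u 1 - r 1) * (v 0 - r 0)
  have hf : ∀ u v, Continuous (f u v) := fun u v => by fun_prop
  have hfp : ∀ u v, f u v (fun i => (p i : ℝ)) = (latticeCross (u - p) (v - p) : ℤ) := by
    intro u v
    simp [f, latticeCross]
  rw [mem_interior]
  refine ⟨{r | 0 < f a b r ∧ 0 < f b c r ∧ 0 < f c a r}, ?_,
    (isOpen_lt continuous_const (hf a b)).inter ((isOpen_lt continuous_const (hf b c)).inter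
      (isOpen_lt continuous_const (hf c a))), ?_⟩
  · rintro r ⟨h1, h2, h3⟩
    have hS : 0 < f a b r + f b c r + f c a r := by positivity
    refine mem_convexHull_three.2 ⟨f b c r / (f a b r + f b c r + f c a r),
      f c a r / (f a b r + f b c r + f c a r), f a b r / (f a b r + f b c r + f c a r),
      by positivity, by positivity, by positivity, by field_simp; ring, ?_⟩
    ext i
    simp only [Pi.add_apply, Pi.smul_apply, smul_eq_mul]
    field_simp
    fin_cases i <;> simp only [f, Fin.zero_eta, Fin.mk_one] <;> ring
  · refine ⟨?_, ?_, ?_⟩ <;> rw [hfp] <;> assumption_mod_cast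

/-- Only one frontier point of a convex set lies on a given ray from an interior point. -/
theorem Convex.eq_of_mem_frontier_of_ray {C : Set (Fin 2 → ℝ)} (hC : Convex ℝ C)
    {p d : Fin 2 → ℝ} (hp : p ∈ interior C) {m n : ℝ} (hm : 0 ≤ m) (hn : 0 ≤ n)
    (hmC : m • d + p ∈ frontier C) (hnC : n • d + p ∈ frontier C) : m = n := by
  wlog hmn : m ≤ n generalizing m n
  · exact (this hn hm hnC hmC (le_of_not_ge hmn)).symm
  rcases hmn.eq_or_lt with h | h
  · exact h
  exfalso
  refine hmC.2 ?_
  have hn0 : 0 < n := hm.trans_lt h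
  have := hC.combo_interior_closure_mem_interior hp hnC.1 (a := 1 - m / n) (b := m / n)
    (by rw [sub_pos, div_lt_one hn0]; exact h) (by positivity) (by ring)
  convert this using 1
  rw [smul_add, smul_smul, div_mul_cancel₀ _ hn0.ne']
  module

theorem LatticeConvex.eq_zero_or_eq_zero {K : Set (Fin 2 → ℤ)} (hK : LatticeConvex K)
    (h0 : (0 : Fin 2 → ℤ) ∈ K) (hsymm : ∀ v ∈ K, -v ∈ K → v = 0) {a b : Fin 2 → ℤ}
    (ha : a ∈ K) (hb : b ∈ K) {x y : ℤ} (hx : 0 ≤ x) (hy : 0 ≤ y) (hxy : 0 < x + y)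
    (h : x • a + y • b = 0) : a = 0 ∨ b = 0 := by
  wlog hle : x ≤ y generalizing a b x y
  · exact (this hb ha hy hx (by omega) (by rw [add_comm, h]) (by omega)).symm
  right
  exact hsymm b hb (hK a ha 0 h0 0 h0 x (y - x) 0 hx (by omega) le_rfl (by omega) _
    (by linear_combination (exp := 1) -h))

theorem exists_add_eq_of_four_le_card {a b c : Fin 2 → ℤ}
    (hD : 0 < latticeCross (b - a) (c - a)) {C : Set (Fin 2 → ℝ)}
    (hC : C = convexHull ℝ {fun i => (a i : ℝ), fun i => (b i : ℝ), fun i => (c i : ℝ)})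
    {S : Finset (Fin 2 → ℤ)} (hS : 4 ≤ S.card)
    (hSC : ∀ p ∈ S, (fun i => (p i : ℝ)) ∈ frontier C) {β : Fin 2 → ℤ}
    (hβ : (fun i => (β i : ℝ)) ∈ convexHull ℝ ({fun i => (((2 : ℤ) • a) i : ℝ),
      fun i => (((2 : ℤ) • b) i : ℝ), fun i => (((2 : ℤ) • c) i : ℝ)} : Set (Fin 2 → ℝ)))
    (hβa : β ≠ (2 : ℤ) • a) (hβb : β ≠ (2 : ℤ) • b) (hβc : β ≠ (2 : ℤ) • c) :
    ∃ s t : Fin 2 → ℤ, s ≠ t ∧ (fun i => (s i : ℝ)) ∈ C ∧ (fun i => (t i : ℝ)) ∈ C ∧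
      s + t = β := by
  have hCc : Convex ℝ C := hC ▸ convex_convexHull ℝ _
  have hCclosed : IsClosed C := by
    rw [hC]
    exact (Set.Finite.isCompact_convexHull (𝕜 := ℝ) (by simp)).isClosed
  have haC : (fun i => (a i : ℝ)) ∈ C := hC ▸ subset_convexHull ℝ _ (by simp)
  have hbC : (fun i => (b i : ℝ)) ∈ C := hC ▸ subset_convexHull ℝ _ (by simp)
  have hcC : (fun i => (c i : ℝ)) ∈ C := hC ▸ subset_convexHull ℝ _ (by simp)
  have hK := hCc.latticeConvex
  have hD' : 0 < latticeCross ((2 : ℤ) • b - (2 : ℤ) • a) ((2 : ℤ) • c - (2 : ℤ) • a) := by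
    simp only [latticeCross, Pi.sub_apply, Pi.smul_apply, smul_eq_mul] at hD ⊢
    linarith
  obtain ⟨hz, hx, hy⟩ := latticeCross_nonneg_of_mem_convexHull hD' hβ
  by_cases hpar : ∃ p : Fin 2 → ℤ, β = (2 : ℤ) • p
  · obtain ⟨p, rfl⟩ := hpar
    have hcr : ∀ u v, latticeCross ((2 : ℤ) • u - (2 : ℤ) • p) ((2 : ℤ) • v - (2 : ℤ) • p) =
        4 * latticeCross (u - p) (v - p) := by
      intro u v
      simp only [latticeCross, Pi.sub_apply, Pi.smul_apply, smul_eq_mul]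
      ring
    rw [hcr] at hx hy hz
    have hsum : latticeCross (a - p) (b - p) + latticeCross (b - p) (c - p) +
        latticeCross (c - p) (a - p) = latticeCross (b - a) (c - a) := by
      simp only [latticeCross, Pi.sub_apply]
      ring
    have hcomb : ∀ u v w : Fin 2 → ℤ,
        latticeCross v w • u + latticeCross w u • v + latticeCross u v • w = 0 := by
      intro u v w
      ext i
      fin_cases i <;> simp [latticeCross] <;> ring
    by_contra! hcon
    have hKp := hK.translate p
    set K := {v : Fin 2 → ℤ | v + p ∈ {v : Fin 2 → ℤ | (fun i => (v i : ℝ)) ∈ C}} with hKdef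
    have haK : a - p ∈ K := by simpa [hKdef] using haC
    have hbK : b - p ∈ K := by simpa [hKdef] using hbC
    have hcK : c - p ∈ K := by simpa [hKdef] using hcC
    have hsymm : ∀ v ∈ K, -v ∈ K → v = 0 := by
      intro v hv hv'
      by_contra hne
      refine hcon (v + p) (-v + p) ?_ hv hv' (by module)
      intro h
      apply hne
      ext i
      have := congrFun h i
      simp only [Pi.add_apply, Pi.neg_apply] at this
      simp only [Pi.zero_apply]
      omega
    have h0 : (0 : Fin 2 → ℤ) ∈ K :=
      hKp _ haK _ hbK _ hcK (latticeCross (b - p) (c - p)) (latticeCross (c - p) (a - p))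
        (latticeCross (a - p) (b - p)) (by omega) (by omega) (by omega) (by omega) _
        (by rw [smul_zero, hcomb])
    have hane : a - p ≠ 0 := fun h => hβa (by rw [sub_eq_zero.1 h])
    have hbne : b - p ≠ 0 := fun h => hβb (by rw [sub_eq_zero.1 h])
    have hcne : c - p ≠ 0 := fun h => hβc (by rw [sub_eq_zero.1 h])
    have hpos : ∀ u ∈ K, ∀ v ∈ K, ∀ w ∈ K, u ≠ 0 → v ≠ 0 → 0 ≤ latticeCross u v →
        0 ≤ latticeCross v w → 0 ≤ latticeCross w u →
        0 < latticeCross u v + latticeCross v w + latticeCross w u → 0 < latticeCross u v := by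
      intro u hu v hv w hw hu0 hv0 h1 h2 h3 h4
      rcases h1.eq_or_lt with h | h
      · have hc := hcomb u v w
        rw [← h, zero_smul, add_zero] at hc
        rcases hKp.eq_zero_or_eq_zero h0 hsymm hu hv h2 h3 (by omega) hc with h | h
        · exact absurd h hu0
        · exact absurd h hv0
      · exact h
    have hab := hpos _ haK _ hbK _ hcK hane hbne (by omega) (by omega) (by omega) (by omega)
    have hbc := hpos _ hbK _ hcK _ haK hbne hcne (by omega) (by omega) (by omega) (by omega)
    have hca := hpos _ hcK _ haK _ hbK hcne hane (by omega) (by omega) (by omega) (by omega)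
    have hint : (fun i => (p i : ℝ)) ∈ interior C :=
      hC ▸ mem_interior_convexHull_of_latticeCross_pos hab hbc hca
    obtain ⟨w, hw⟩ := hKp.exists_three_rays h0 hsymm haK hbK hcK hab hbc hca
    have hray : ∀ s : Fin 2 → ℤ, ∃ i, s ∈ S → ∃ n : ℤ, 0 ≤ n ∧ s - p = n • w i := by
      intro s
      by_cases hs : s ∈ S
      · obtain ⟨i, hi⟩ := hw (s - p) (by simpa [hKdef] using hCclosed.frontier_subset (hSC s hs))
        exact ⟨i, fun _ => hi⟩
      · exact ⟨0, fun h => absurd h hs⟩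
    choose i hi using hray
    obtain ⟨s, hs, t, ht, hst, hit⟩ := Finset.exists_ne_map_eq_of_card_lt_of_maps_to
      (s := S) (t := Finset.univ) (f := i) (by simp; omega) (by simp)
    obtain ⟨m, hm, hsm⟩ := hi s hs
    obtain ⟨n, hn, htn⟩ := hi t ht
    rw [← hit] at htn
    have hcast : ∀ (r : Fin 2 → ℤ) (k : ℤ), r - p = k • w (i s) →
        (fun j => (r j : ℝ)) = (k : ℝ) • (fun j => (w (i s) j : ℝ)) + fun j => (p j : ℝ) := by
      intro r k h
      ext j
      have h := congrFun h j
      simp only [Pi.sub_apply, Pi.smul_apply, smul_eq_mul] at h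
      simp only [Pi.add_apply, Pi.smul_apply, smul_eq_mul]
      exact_mod_cast sub_eq_iff_eq_add.1 h
    have hmn : (m : ℝ) = n := hCc.eq_of_mem_frontier_of_ray hint (by exact_mod_cast hm)
      (by exact_mod_cast hn) (hcast s m hsm ▸ hSC s hs) (hcast t n htn ▸ hSC t ht)
    refine hst (sub_left_injective (b := p) ?_)
    simp only [hsm, htn]
    rw [Int.cast_injective hmn]
  · obtain ⟨s, hs, t, ht, hst⟩ := hK.exists_add_eq β _ a haC b hbC c hcC _ _ _ hx hy hz
      (by
        simp only [latticeCross, Pi.sub_apply, Pi.smul_apply, smul_eq_mul] at hD ⊢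
        linarith)
      (Int.self_le_toNat _) (by
        ext i
        fin_cases i <;> simp [latticeCross] <;> ring)
    refine ⟨s, t, ?_, hs, ht, hst⟩
    rintro rfl
    exact hpar ⟨s, by rw [← hst]; module⟩

/-- Let `Δ = conv{v₀,v₁,v₂} ⊂ ℝ²` be a triangle with even lattice
vertices such that the boundary of `½Δ` contains at least four lattice points. Then `Δ` is
an `H`-simplex: every non-vertex lattice point of `Δ` is the midpoint of two distinct even
lattice points of `Δ`. -/
theorem four_boundary_points_H_simplex
    (v₀ v₁ v₂ : Fin 2 → ℕ)
    (hv₀ : ∀ i, Even (v₀ i)) (hv₁ : ∀ i, Even (v₁ i)) (hv₂ : ∀ i, Even (v₂ i))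
    (haff : AffineIndependent ℝ
      ![(fun i : Fin 2 => (v₀ i : ℝ)), (fun i : Fin 2 => (v₁ i : ℝ)),
        (fun i : Fin 2 => (v₂ i : ℝ))])
    (hbd : ∃ S : Finset (Fin 2 → ℤ), 4 ≤ S.card ∧
      ∀ p ∈ S, (fun i => (p i : ℝ)) ∈ frontier (convexHull ℝ
        ({(fun i : Fin 2 => (v₀ i : ℝ) / 2), (fun i : Fin 2 => (v₁ i : ℝ) / 2),
          (fun i : Fin 2 => (v₂ i : ℝ) / 2)} : Set (Fin 2 → ℝ)))) :
    ∀ β : Fin 2 → ℤ,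
      ((fun i => (β i : ℝ)) ∈ convexHull ℝ
        ({(fun i : Fin 2 => (v₀ i : ℝ)), (fun i : Fin 2 => (v₁ i : ℝ)),
          (fun i : Fin 2 => (v₂ i : ℝ))} : Set (Fin 2 → ℝ))) →
      (β ≠ (fun i => (v₀ i : ℤ)) ∧ β ≠ (fun i => (v₁ i : ℤ)) ∧ β ≠ (fun i => (v₂ i : ℤ))) →
      ∃ s t : Fin 2 → ℤ, s ≠ t ∧
        (∀ i, Even (s i)) ∧ (∀ i, Even (t i)) ∧
        ((fun i => (s i : ℝ)) ∈ convexHull ℝ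
          ({(fun i : Fin 2 => (v₀ i : ℝ)), (fun i : Fin 2 => (v₁ i : ℝ)),
            (fun i : Fin 2 => (v₂ i : ℝ))} : Set (Fin 2 → ℝ))) ∧
        ((fun i => (t i : ℝ)) ∈ convexHull ℝ
          ({(fun i : Fin 2 => (v₀ i : ℝ)), (fun i : Fin 2 => (v₁ i : ℝ)),
            (fun i : Fin 2 => (v₂ i : ℝ))} : Set (Fin 2 → ℝ))) ∧
        ∀ i, 2 * β i = s i + t i := by
  intro β hβ ⟨hβ₀, hβ₁, hβ₂⟩
  have hhalf : ∀ v : Fin 2 → ℕ, (∀ i, Even (v i)) → ∃ a : Fin 2 → ℤ,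
      (fun i => (v i : ℤ)) = (2 : ℤ) • a ∧ (fun i => (v i : ℝ) / 2) = (fun i => (a i : ℝ)) ∧
      (fun i => (v i : ℝ)) = (fun i => (((2 : ℤ) • a) i : ℝ)) := by
    intro v hv
    choose w hw using hv
    refine ⟨fun i => w i, ?_, ?_, ?_⟩ <;> ext i <;> simp [hw] <;> ring
  obtain ⟨a, ha, ha', ha''⟩ := hhalf v₀ hv₀
  obtain ⟨b, hb, hb', hb''⟩ := hhalf v₁ hv₁
  obtain ⟨c, hc, hc', hc''⟩ := hhalf v₂ hv₂
  obtain ⟨S, hS, hSC⟩ := hbd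
  rw [ha'', hb'', hc''] at haff hβ ⊢
  rw [ha', hb', hc'] at hSC
  rw [ha] at hβ₀
  rw [hb] at hβ₁
  rw [hc] at hβ₂
  have hD : latticeCross (b - a) (c - a) ≠ 0 := by
    intro h
    have hcross : ((b 0 : ℝ) - a 0) * (c 1 - a 1) - (b 1 - a 1) * (c 0 - a 0) = 0 := by
      exact_mod_cast h
    have hzero : ∀ j, (b j : ℝ) = a j := by
      intro j
      have := affineIndependent_iff.1 haff Finset.univ
        ![(b j : ℝ) - c j, (c j : ℝ) - a j, -((b j : ℝ) - a j)]
        (by simp [Fin.sum_univ_three])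
        (by
          ext i
          fin_cases i <;> fin_cases j <;> simp [Fin.sum_univ_three] <;> linarith)
        2 (Finset.mem_univ _)
      simp at this
      linarith
    have hne := haff.injective.ne (show (0 : Fin 3) ≠ 1 by decide)
    refine hne ?_
    ext j
    simp [hzero j]
  have main : ∃ s t : Fin 2 → ℤ, s ≠ t ∧
      (fun i => (s i : ℝ)) ∈ convexHull ℝ
        ({fun i => (a i : ℝ), fun i => (b i : ℝ), fun i => (c i : ℝ)} : Set (Fin 2 → ℝ)) ∧
      (fun i => (t i : ℝ)) ∈ convexHull ℝ
        ({fun i => (a i : ℝ), fun i => (b i : ℝ), fun i => (c i : ℝ)} : Set (Fin 2 → ℝ)) ∧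
      s + t = β := by
    rcases hD.lt_or_gt with hD | hD
    · refine exists_add_eq_of_four_le_card (a := a) (b := c) (c := b) ?_
        (by rw [Set.pair_comm]) hS hSC (by rwa [Set.pair_comm] at hβ) hβ₀ hβ₂ hβ₁
      simp only [latticeCross, Pi.sub_apply] at hD ⊢
      linarith
    · exact exists_add_eq_of_four_le_card hD rfl hS hSC hβ hβ₀ hβ₁ hβ₂
  have hdouble : ∀ s : Fin 2 → ℤ, (fun i => (s i : ℝ)) ∈ convexHull ℝ
        ({fun i => (a i : ℝ), fun i => (b i : ℝ), fun i => (c i : ℝ)} : Set (Fin 2 → ℝ)) →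
      (fun i => (((2 : ℤ) • s) i : ℝ)) ∈ convexHull ℝ
        ({fun i => (((2 : ℤ) • a) i : ℝ), fun i => (((2 : ℤ) • b) i : ℝ),
          fun i => (((2 : ℤ) • c) i : ℝ)} : Set (Fin 2 → ℝ)) := by
    intro s hs
    obtain ⟨x, y, z, hx, hy, hz, hsum, h⟩ := mem_convexHull_three.1 hs
    refine mem_convexHull_three.2 ⟨x, y, z, hx, hy, hz, hsum, ?_⟩
    ext i
    have h := congrFun h i
    simp only [Pi.add_apply, Pi.smul_apply, smul_eq_mul] at h ⊢
    push_cast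
    linear_combination 2 * h
  obtain ⟨s, t, hst, hs, ht, rfl⟩ := main
  refine ⟨(2 : ℤ) • s, (2 : ℤ) • t, ?_, by simp, by simp, hdouble s hs, hdouble t ht, ?_⟩
  · exact fun h => hst (smul_right_injective _ two_ne_zero h)
  · intro i
    simp [mul_add]
end

section
/- Let d ≥ 1, let y be a natural number with 0 < y < 2d, let a ∈ ℝ \ {0} and b > 0, and define f : ℝ → ℝ by f(x) = 1 + a·x^y + b·x^{2d}. Then f is convex on ℝ if and only if y = 1, or (y is even and a > 0). -/
/-- If `c t ^ m + e t ^ n ≥ 0` for all `t > 0`, where `m < n`, then the lower order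
coefficient `c` is nonnegative. -/
theorem nonneg_of_forall_pos_add_pow_nonneg {m n : ℕ} (hmn : m < n) {c e : ℝ}
    (h : ∀ t : ℝ, 0 < t → 0 ≤ c * t ^ m + e * t ^ n) : 0 ≤ c := by
  obtain ⟨k, rfl⟩ := Nat.exists_eq_add_of_lt hmn
  have hlim : Filter.Tendsto (fun t : ℝ => c + e * t ^ (k + 1)) (nhdsWithin 0 (Set.Ioi 0))
      (nhds c) := by
    have hc : Continuous fun t : ℝ => c + e * t ^ (k + 1) := by fun_prop
    have h0 := hc.tendsto 0
    simp only [ne_eq, Nat.add_eq_zero_iff, one_ne_zero, and_false, not_false_eq_true, zero_pow,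
      mul_zero, add_zero] at h0
    exact h0.mono_left nhdsWithin_le_nhds
  refine ge_of_tendsto hlim ?_
  filter_upwards [self_mem_nhdsWithin] with t ht
  have ht' : 0 < t ^ m := pow_pos ht m
  refine nonneg_of_mul_nonneg_right ?_ ht'
  calc 0 ≤ c * t ^ m + e * t ^ (m + k + 1) := h t ht
    _ = t ^ m * (c + e * t ^ (k + 1)) := by ring

/-- For `f(x) = 1 + a x^y + b x^{2d}` with `0 < y < 2d`, `a ≠ 0`, `b > 0`,
the function `f` is convex on ℝ iff `y = 1`, or `y` is even and `a > 0`. -/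
theorem univariate_circuit_convex_iff
    (d : ℕ) (hd : 1 ≤ d)
    (y : ℕ) (hy0 : 0 < y) (hy2d : y < 2 * d)
    (a : ℝ) (ha : a ≠ 0) (b : ℝ) (hb : 0 < b) :
    ConvexOn ℝ Set.univ (fun x : ℝ => 1 + a * x ^ y + b * x ^ (2 * d)) ↔
      y = 1 ∨ (Even y ∧ 0 < a) := by
  constructor
  · intro hf
    rw [or_iff_not_imp_left]
    intro hy1
    have hd0 : 2 * d ≠ 0 := by omega
    -- Midpoint convexity between `0` and `x`.
    have hmid (x : ℝ) : 0 ≤ a * (1 / 2 - (1 / 2) ^ y) * x ^ y +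
        b * (1 / 2 - (1 / 2) ^ (2 * d)) * x ^ (2 * d) := by
      have h := hf.2 (Set.mem_univ x) (Set.mem_univ 0)
        (show (0 : ℝ) ≤ 1 / 2 by norm_num) (show (0 : ℝ) ≤ 1 / 2 by norm_num) (by norm_num)
      simp only [smul_eq_mul, mul_zero, add_zero, mul_pow, zero_pow hy0.ne', zero_pow hd0] at h
      linarith
    have hc : (0 : ℝ) < 1 / 2 - (1 / 2) ^ y := by
      have : (1 / 2 : ℝ) ^ y ≤ (1 / 2) ^ 2 :=
        pow_le_pow_of_le_one (by norm_num) (by norm_num) (by omega)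
      linarith
    have ha_pos : 0 < a := lt_of_le_of_ne
      (nonneg_of_mul_nonneg_left
        (nonneg_of_forall_pos_add_pow_nonneg hy2d fun t _ => hmid t) hc) ha.symm
    refine ⟨?_, ha_pos⟩
    by_contra hodd
    rw [Nat.not_even_iff_odd] at hodd
    have hneg : 0 ≤ -(a * (1 / 2 - (1 / 2) ^ y)) := by
      refine nonneg_of_forall_pos_add_pow_nonneg hy2d
        (e := b * (1 / 2 - (1 / 2) ^ (2 * d))) fun t _ => ?_
      have h := hmid (-t)
      rw [hodd.neg_pow, (even_two_mul d).neg_pow] at h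
      linarith
    linarith [mul_pos ha_pos hc]
  · intro h
    have hb_convex : ConvexOn ℝ Set.univ fun x : ℝ => b * x ^ (2 * d) :=
      (even_two_mul d).convexOn_pow.smul hb.le
    have ha_convex : ConvexOn ℝ Set.univ fun x : ℝ => a * x ^ y := by
      rcases h with rfl | ⟨hy, ha_pos⟩
      · refine ⟨convex_univ, fun u _ v _ s t _ _ _ => le_of_eq ?_⟩
        simp only [smul_eq_mul]
        ring
      · exact hy.convexOn_pow.smul ha_pos.le
    exact ((convexOn_const 1 convex_univ).add ha_convex).add hb_convex
end

section
/- The polynomial f = 3/10 + (1/10)·X⁴ + (1/5)·X⁴Y² + (2/5)·X²Y⁴ − X²Y² ∈ ℝ[X,Y] is nonnegative on ℝ² but is not a sum of squares of polynomials: there do not exist polynomials q_1,…,q_m ∈ ℝ[X,Y] with f = Σ_{i=1}^{m} q_i². -/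
open MvPolynomial

/-- If a vanishing sum of squares in `R` has only zero terms, then the terms of a sum of squares of
polynomials over `R` have at most half the degree of the sum. -/
theorem Polynomial.natDegree_le_of_natDegree_sum_sq_le {R ι : Type*} [CommRing R] [Fintype ι]
    (hR : ∀ r : ι → R, ∑ i, r i ^ 2 = 0 → ∀ i, r i = 0) (p : ι → Polynomial R) {d : ℕ}
    (h : (∑ i, p i ^ 2).natDegree ≤ 2 * d) (i : ι) : (p i).natDegree ≤ d := by
  obtain ⟨j, -, hj⟩ := Finset.exists_max_image Finset.univ (fun i => (p i).natDegree)
    ⟨i, Finset.mem_univ i⟩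
  refine (hj i (Finset.mem_univ i)).trans ?_
  by_contra! hd
  have hlead : ∑ i, (p i).coeff (p j).natDegree ^ 2 = 0 := by
    rw [← Polynomial.coeff_eq_zero_of_natDegree_lt
      (show (∑ i, p i ^ 2).natDegree < 2 * (p j).natDegree by omega), Polynomial.finsetSum_coeff]
    exact Finset.sum_congr rfl fun i hi =>
      (Polynomial.coeff_pow_of_natDegree_le (hj i hi)).symm
  have hp : p j = 0 := Polynomial.leadingCoeff_eq_zero.mp (hR _ hlead j)
  simp [hp] at hd

theorem eq_zero_of_sum_sq_eq_zero {ι : Type*} [Fintype ι] (r : ι → ℝ) (h : ∑ i, r i ^ 2 = 0)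
    (i : ι) : r i = 0 :=
  pow_eq_zero_iff two_ne_zero |>.mp <|
    (Finset.sum_eq_zero_iff_of_nonneg fun i _ => sq_nonneg (r i)).mp h i (Finset.mem_univ i)

theorem Polynomial.eq_zero_of_sum_sq_eq_zero {ι : Type*} [Fintype ι] (r : ι → Polynomial ℝ)
    (h : ∑ i, r i ^ 2 = 0) (i : ι) : r i = 0 :=
  Polynomial.funext fun t => by
    have ht := congrArg (Polynomial.eval t) h
    simp only [Polynomial.eval_finsetSum, Polynomial.eval_pow, Polynomial.eval_zero] at ht
    simpa using _root_.eq_zero_of_sum_sq_eq_zero _ ht i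

theorem quadrilateral_form_nonneg {a b : ℝ} (ha : 0 ≤ a) (hb : 0 ≤ b) :
    0 ≤ 3 / 10 + 1 / 10 * a ^ 2 + 1 / 5 * a ^ 2 * b + 2 / 5 * a * b ^ 2 - a * b := by
  rcases le_total a 5 with h5 | h5
  · have hsq : 16 * (3 + a ^ 2 + 2 * a ^ 2 * b + 4 * a * b ^ 2 - 10 * a * b)
        = a * (8 * b + 2 * (a - 5)) ^ 2 + 4 * (a - 1) ^ 2 * (12 - a) := by ring
    have h1 : 0 ≤ a * (8 * b + 2 * (a - 5)) ^ 2 := by positivity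
    have h2 : 0 ≤ 4 * (a - 1) ^ 2 * (12 - a) := mul_nonneg (by positivity) (by linarith)
    linarith
  · have h1 : 0 ≤ a * b * (a - 5) := mul_nonneg (mul_nonneg ha hb) (by linarith)
    have h2 : 0 ≤ a * b ^ 2 := by positivity
    nlinarith [sq_nonneg a]

/-- The quadrilateral polynomial, viewed as a polynomial in the first variable over `ℝ[Y]`, is not
a sum of squares. -/
theorem quadrilateral_ne_sum_sq {ι : Type*} [Fintype ι] (p : ι → Polynomial (Polynomial ℝ)) :
    ∑ i, p i ^ 2 ≠ Polynomial.C (Polynomial.C (1 / 10) + Polynomial.C (1 / 5) * Polynomial.X ^ 2)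
        * Polynomial.X ^ 4
      + Polynomial.C (Polynomial.C (2 / 5) * Polynomial.X ^ 4 - Polynomial.X ^ 2)
        * Polynomial.X ^ 2
      + Polynomial.C (Polynomial.C (3 / 10)) := by
  intro hp
  have hdeg := Polynomial.natDegree_le_of_natDegree_sum_sq_le (d := 2)
    Polynomial.eq_zero_of_sum_sq_eq_zero p (by rw [hp]; compute_degree)
  have hlead : ∑ i, (p i).coeff 2 ^ 2
      = Polynomial.C (1 / 10) + Polynomial.C (1 / 5) * Polynomial.X ^ 2 := by
    have h := congrArg (fun r => r.coeff (2 * 2)) hp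
    simp only [Polynomial.finsetSum_coeff, fun i => Polynomial.coeff_pow_of_natDegree_le (m := 2)
      (hdeg i)] at h
    rw [h]
    simp [Polynomial.coeff_X_pow, -map_add, -map_sub, -map_mul]
  have hconst : ∑ i, (p i).coeff 0 ^ 2 = Polynomial.C (3 / 10) := by
    have h := congrArg (Polynomial.eval 0) hp
    simpa [Polynomial.eval_finsetSum, ← Polynomial.coeff_zero_eq_eval_zero] using h
  have hlead_deg := Polynomial.natDegree_le_of_natDegree_sum_sq_le (d := 1)
    eq_zero_of_sum_sq_eq_zero (fun i => (p i).coeff 2) (by rw [hlead]; compute_degree)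
  have hconst_deg := Polynomial.natDegree_le_of_natDegree_sum_sq_le (d := 0)
    eq_zero_of_sum_sq_eq_zero (fun i => (p i).coeff 0) (by rw [hconst]; compute_degree)
  have hroot (s t : ℝ) (hs : s ^ 2 = 1) (ht : t ^ 2 = 1) (i : ι) :
      ((p i).eval (Polynomial.C s)).eval t = 0 := by
    refine eq_zero_of_sum_sq_eq_zero (fun i => ((p i).eval (Polynomial.C s)).eval t) ?_ i
    have h := congrArg (fun r => (r.eval (Polynomial.C s)).eval t) hp
    simp only [Polynomial.eval_finsetSum, Polynomial.eval_pow] at h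
    rw [h]
    have hs4 : s ^ 4 = 1 := by rw [show s ^ 4 = (s ^ 2) ^ 2 by ring, hs, one_pow]
    have ht4 : t ^ 4 = 1 := by rw [show t ^ 4 = (t ^ 2) ^ 2 by ring, ht, one_pow]
    simp [hs, ht, hs4, ht4]
    norm_num
  have hlin (i : ι) : ((p i).coeff 2).coeff 1 = 0 := by
    have expand (s t : ℝ) : ((p i).eval (Polynomial.C s)).eval t
        = ((p i).coeff 0).coeff 0 + ((p i).coeff 1).eval t * s
          + (((p i).coeff 2).coeff 0 + ((p i).coeff 2).coeff 1 * t) * s ^ 2 := by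
      rw [Polynomial.eval_eq_sum_range' (Nat.lt_succ_of_le (hdeg i))]
      simp only [Finset.sum_range_succ, Finset.sum_range_zero, Polynomial.eval_add,
        Polynomial.eval_mul, Polynomial.eval_pow, Polynomial.eval_C]
      rw [Polynomial.eval_eq_sum_range' (Nat.lt_succ_of_le (hlead_deg i)) t,
        Polynomial.eval_eq_sum_range' (Nat.lt_succ_of_le (hconst_deg i)) t]
      simp [Finset.sum_range_succ]
    have h1 := hroot 1 1 (by norm_num) (by norm_num) i
    have h2 := hroot 1 (-1) (by norm_num) (by norm_num) i
    have h3 := hroot (-1) 1 (by norm_num) (by norm_num) i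
    have h4 := hroot (-1) (-1) (by norm_num) (by norm_num) i
    rw [expand] at h1 h2 h3 h4
    linarith
  have h := congrArg (fun r => r.coeff (2 * 1)) hlead
  simp only [Polynomial.finsetSum_coeff, fun i => Polynomial.coeff_pow_of_natDegree_le (m := 2)
    (hlead_deg i), hlin] at h
  simp at h

/-- The polynomial
`f = 3/10 + (1/10) X⁴ + (1/5) X⁴Y² + (2/5) X²Y⁴ − X²Y²` is nonnegative on ℝ² but is not a
sum of squares of polynomials. -/
theorem reznick_quadrilateral_counterexample
    (f : MvPolynomial (Fin 2) ℝ)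
    (hf : f = C (3 / 10) + C (1 / 10) * X 0 ^ 4 + C (1 / 5) * X 0 ^ 4 * X 1 ^ 2
        + C (2 / 5) * X 0 ^ 2 * X 1 ^ 4 - X 0 ^ 2 * X 1 ^ 2) :
    (∀ x : Fin 2 → ℝ, 0 ≤ eval x f) ∧
    ¬ ∃ (m : ℕ) (q : Fin m → MvPolynomial (Fin 2) ℝ), f = ∑ i, q i ^ 2 := by
  subst hf
  refine ⟨fun x => ?_, ?_⟩
  · have h := quadrilateral_form_nonneg (sq_nonneg (x 0)) (sq_nonneg (x 1))
    simp only [map_add, map_sub, map_mul, map_pow, eval_C, eval_X]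
    linarith
  · rintro ⟨m, q, hq⟩
    let φ : MvPolynomial (Fin 2) ℝ →ₐ[ℝ] Polynomial (Polynomial ℝ) :=
      aeval ![Polynomial.X, Polynomial.C Polynomial.X]
    have hC (c : ℝ) : φ (C c) = Polynomial.C (Polynomial.C c) := by
      simp only [φ, aeval_C]
      rfl
    have h := congrArg φ hq
    simp only [map_sum, map_pow, map_add, map_sub, map_mul, hC] at h
    refine quadrilateral_ne_sum_sq (fun i => φ (q i)) (h.symm.trans ?_)
    simp only [φ, aeval_X, Matrix.cons_val_zero, Matrix.cons_val_one, map_add, map_sub, map_mul,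
      map_pow]
    ring
end
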